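/- arXiv:1911.03652 — 2 statements merged into one kernel-verified Lean document; each statement's English description precedes it below -/
import Mathlib

section
/- Suppose Δ_SA is nonempty and det(g(x),[g,[f,g]](x)) ≠ 0 for every x ∈ Δ_SA. Then for every x₀ ∈ Δ_SA \ Δ₀ one has ∇δ_SA(x₀) ≠ 0, and there exist an open neighborhood U of x₀ with U ∩ Δ₀ = ∅, an open interval J ⊆ ℝ, and an injective C¹ map ζ : J → ℝ² such that ζ(J) = Δ_SA ∩ U; that is, near each of its points Δ_SA \ Δ₀ is a one-to-one C¹-parametrized curve. -/
open Set

noncomputable section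

/-- The plane, with its Euclidean (inner product) structure. -/
abbrev E2 : Type := EuclideanSpace ℝ (Fin 2)

/-- `det(a,b) = a₁b₂ − a₂b₁`. -/
def det2 (a b : E2) : ℝ := a 0 * b 1 - a 1 * b 0

/-- Lie bracket `[f,g](x) = Dg(x)f(x) − Df(x)g(x)`. -/
def lieB (f g : E2 → E2) (x : E2) : E2 :=
  fderiv ℝ g x (f x) - fderiv ℝ f x (g x)

/-- `δ_SA(x) = det(g(x),[f,g](x))`. -/
def δSA (f g : E2 → E2) (x : E2) : ℝ := det2 (g x) (lieB f g x)

lemma det2_sub_right (a b c : E2) : det2 a (b - c) = det2 a b - det2 a c := by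
  simp only [det2, PiLp.sub_apply]; ring

/-- The plane vectors `a ≠ 0` and `b` are parallel when their determinant vanishes. -/
lemma exists_eq_smul_of_det2_eq_zero {a b : E2} (ha : a ≠ 0) (h : det2 a b = 0) :
    ∃ c : ℝ, b = c • a := by
  unfold det2 at h
  by_cases h0 : a 0 = 0
  · have h1 : a 1 ≠ 0 := fun h1 => ha (by ext i; fin_cases i <;> simp [h0, h1])
    refine ⟨b 1 / a 1, ?_⟩
    have hb : b 0 = 0 := by simpa [h0, h1] using h
    ext i; fin_cases i <;> simp [h0, hb, h1]
  · refine ⟨b 0 / a 0, ?_⟩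
    ext i; fin_cases i
    · simp [h0]
    · simp only [Fin.mk_one, PiLp.smul_apply, smul_eq_mul]
      field_simp
      linarith

/-- The linear functional `det(a, ·)`. -/
def det2Left (a : E2) : E2 →L[ℝ] ℝ :=
  a 0 • EuclideanSpace.proj 1 - a 1 • EuclideanSpace.proj 0

lemma det2Left_apply (a v : E2) : det2Left a v = det2 a v := by
  simp [det2Left, det2]

lemma HasFDerivAt.det2 {a b : E2 → E2} {a' b' : E2 →L[ℝ] E2} {x : E2}
    (ha : HasFDerivAt a a' x) (hb : HasFDerivAt b b' x) :
    ∃ L : E2 →L[ℝ] ℝ, HasFDerivAt (fun y => det2 (a y) (b y)) L x ∧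
      ∀ v, L v = _root_.det2 (a' v) (b x) + _root_.det2 (a x) (b' v) := by
  have hA := fun i => ((EuclideanSpace.proj i : E2 →L[ℝ] ℝ).hasFDerivAt).comp x ha
  have hB := fun i => ((EuclideanSpace.proj i : E2 →L[ℝ] ℝ).hasFDerivAt).comp x hb
  refine ⟨_, ((hA 0).mul (hB 1)).sub ((hA 1).mul (hB 0)), fun v => ?_⟩
  simp [_root_.det2]
  ring

lemma ContDiff.det2 {n : WithTop ℕ∞} {a b : E2 → E2} (ha : ContDiff ℝ n a)
    (hb : ContDiff ℝ n b) : ContDiff ℝ n (fun y => det2 (a y) (b y)) := by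
  have hA := contDiff_euclidean.1 ha
  have hB := contDiff_euclidean.1 hb
  exact ((hA 0).mul (hB 1)).sub ((hA 1).mul (hB 0))

lemma ContDiff.lieB {f g : E2 → E2} (hf : ContDiff ℝ (⊤ : ℕ∞) f)
    (hg : ContDiff ℝ (⊤ : ℕ∞) g) : ContDiff ℝ (⊤ : ℕ∞) (lieB f g) :=
  ((hg.fderiv_right (m := (⊤ : ℕ∞)) (by simp)).clm_apply hf).sub
    ((hf.fderiv_right (m := (⊤ : ℕ∞)) (by simp)).clm_apply hg)

/-- On `Δ_SA`, away from the zeros of `g`, the derivative of `δ_SA` along `g` is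
`det(g,[g,[f,g]])`. -/
lemma fderiv_δSA_apply {f g : E2 → E2} (hf : ContDiff ℝ (⊤ : ℕ∞) f)
    (hg : ContDiff ℝ (⊤ : ℕ∞) g) {x : E2} (hx : δSA f g x = 0) (hgx : g x ≠ 0) :
    fderiv ℝ (δSA f g) x (g x) = det2 (g x) (lieB g (lieB f g) x) := by
  obtain ⟨L, hL, hLv⟩ :=
    (hg.differentiable (by simp) x).hasFDerivAt.det2
      ((hf.lieB hg).differentiable (by simp) x).hasFDerivAt
  obtain ⟨c, hc⟩ := exists_eq_smul_of_det2_eq_zero hgx hx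
  have hL' : fderiv ℝ (δSA f g) x = L := hL.fderiv
  have hbr : lieB g (lieB f g) x =
      fderiv ℝ (lieB f g) x (g x) - fderiv ℝ g x (lieB f g x) := rfl
  rw [hL', hLv, hbr, det2_sub_right, hc]
  simp only [det2, map_smul, PiLp.smul_apply, smul_eq_mul]
  ring

/-- Near a zero at which its derivative does not vanish, the zero set of a `C¹` function on the
plane is an injectively parametrized `C¹` curve. -/
lemma exists_param_zeroSet {δ : E2 → ℝ} {x₀ w : E2} (hδ : ContDiffAt ℝ 1 δ x₀) (h0 : δ x₀ = 0)
    (hw : fderiv ℝ δ x₀ w ≠ 0) {V : Set E2} (hV : IsOpen V) (hxV : x₀ ∈ V) :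
    ∃ U : Set E2, IsOpen U ∧ x₀ ∈ U ∧ U ⊆ V ∧
      ∃ (a b : ℝ) (ζ : ℝ → E2), a < b ∧
        ContDiffOn ℝ 1 ζ (Ioo a b) ∧ InjOn ζ (Ioo a b) ∧
        ζ '' Ioo a b = {x : E2 | δ x = 0} ∩ U := by
  set ℓ := det2Left w with hℓ
  have hw0 : w ≠ 0 := by rintro rfl; simp at hw
  let T : E2 →L[ℝ] ℝ × ℝ := (fderiv ℝ δ x₀).prod ℓ
  have hT : Function.Injective T.toLinearMap := by
    refine (injective_iff_map_eq_zero _).2 fun v hv => ?_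
    have hv' : fderiv ℝ δ x₀ v = 0 ∧ ℓ v = 0 := by simpa [T] using hv
    obtain ⟨c, rfl⟩ := exists_eq_smul_of_det2_eq_zero hw0
      ((det2Left_apply w v).symm.trans hv'.2)
    have hc : c = 0 := by simpa [hw] using hv'.1
    simp [hc]
  let A : E2 ≃L[ℝ] ℝ × ℝ :=
    (LinearEquiv.ofInjectiveOfFinrankEq T.toLinearMap hT (by simp)).toContinuousLinearEquiv
  have hA : (A : E2 →L[ℝ] ℝ × ℝ) = T := by ext v <;> rfl
  have hΦ : ContDiffAt ℝ 1 (fun x => (δ x, ℓ x)) x₀ := hδ.prodMk ℓ.contDiff.contDiffAt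
  have hΦ' : HasFDerivAt (fun x => (δ x, ℓ x)) (A : E2 →L[ℝ] ℝ × ℝ) x₀ := by
    rw [hA]
    exact (hδ.differentiableAt (by simp)).hasFDerivAt.prodMk ℓ.hasFDerivAt
  let e := hΦ.toOpenPartialHomeomorph _ hΦ' (by simp)
  have he : ∀ x, e x = (δ x, ℓ x) := fun x => rfl
  have hxe : x₀ ∈ e.source := hΦ.mem_toOpenPartialHomeomorph_source hΦ' (by simp)
  have hsymm : ContDiffAt ℝ 1 e.symm (e x₀) := hΦ.to_localInverse hΦ' (by simp)
  have hnhds : ∀ᶠ y in nhds (e x₀), ContDiffAt ℝ 1 e.symm y ∧ y ∈ e.target ∧ e.symm y ∈ V := by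
    refine (hsymm.eventually (by simp)).and
      (Filter.Eventually.and (e.open_target.mem_nhds (e.map_source hxe)) (hsymm.continuousAt.eventually ?_))
    rw [e.left_inv hxe]
    exact hV.mem_nhds hxV
  rw [Metric.eventually_nhds_iff_ball] at hnhds
  obtain ⟨ε, hε, hball⟩ := hnhds
  have hmem : ∀ t ∈ Ioo (ℓ x₀ - ε) (ℓ x₀ + ε), ((0 : ℝ), t) ∈ Metric.ball (e x₀) ε := by
    intro t ht
    rw [he, h0, ← ball_prod_same]
    exact ⟨Metric.mem_ball_self hε, by rwa [Real.ball_eq_Ioo]⟩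
  refine ⟨e.source ∩ e ⁻¹' Metric.ball (e x₀) ε, e.isOpen_inter_preimage Metric.isOpen_ball,
    ⟨hxe, Metric.mem_ball_self hε⟩, fun x hx => ?_, ℓ x₀ - ε, ℓ x₀ + ε,
    fun t => e.symm (0, t), by linarith, fun t ht => ?_, fun s hs t ht hst => ?_, ?_⟩
  · simpa only [e.left_inv hx.1] using (hball _ hx.2).2.2
  · exact ((hball _ (hmem t ht)).1.comp t
      (contDiffAt_const.prodMk contDiffAt_id)).contDiffWithinAt
  · exact congrArg Prod.snd
      (e.symm.injOn (hball _ (hmem s hs)).2.1 (hball _ (hmem t ht)).2.1 hst)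
  · ext x
    constructor
    · rintro ⟨t, ht, rfl⟩
      have htt := (hball _ (hmem t ht)).2.1
      have hr := e.right_inv htt
      refine ⟨congrArg Prod.fst hr, e.map_target htt, ?_⟩
      rw [mem_preimage, hr]
      exact hmem t ht
    · rintro ⟨hx, hxs, hxb⟩
      refine ⟨ℓ x, ?_, ?_⟩
      · rw [mem_preimage, he, he, ← ball_prod_same] at hxb
        simpa only [Real.ball_eq_Ioo] using hxb.2
      · have hx' : e x = (0, ℓ x) := by rw [he, show δ x = 0 from hx]
        simp only [← hx', e.left_inv hxs]

/-- if `Δ_SA ≠ ∅` and `det(g,[g,[f,g]]) ≠ 0` on `Δ_SA`, then near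
each point `x₀ ∈ Δ_SA \ Δ₀` one has `∇δ_SA(x₀) ≠ 0` and `Δ_SA \ Δ₀` is a
one-to-one `C¹`-parametrized curve: there are an open neighborhood `U` of `x₀`
disjoint from `Δ₀`, an open interval `J` and an injective `C¹` map
`ζ : J → ℝ²` with `ζ(J) = Δ_SA ∩ U`. -/
theorem stmt6 (f g : E2 → E2)
    (hf : ContDiff ℝ (⊤ : ℕ∞) f) (hg : ContDiff ℝ (⊤ : ℕ∞) g)
    (hne : {x : E2 | δSA f g x = 0}.Nonempty)
    (hB : ∀ x : E2, δSA f g x = 0 → det2 (g x) (lieB g (lieB f g) x) ≠ 0) :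
    ∀ x₀ : E2, δSA f g x₀ = 0 → det2 (f x₀) (g x₀) ≠ 0 →
      gradient (δSA f g) x₀ ≠ 0 ∧
      ∃ U : Set E2, IsOpen U ∧ x₀ ∈ U ∧ (∀ x ∈ U, det2 (f x) (g x) ≠ 0) ∧
        ∃ (a b : ℝ) (ζ : ℝ → E2), a < b ∧
          ContDiffOn ℝ 1 ζ (Ioo a b) ∧ InjOn ζ (Ioo a b) ∧
          ζ '' Ioo a b = {x : E2 | δSA f g x = 0} ∩ U := by
  intro x₀ hx₀ hfg
  have hgx : g x₀ ≠ 0 := fun h => hfg (by simp [det2, h])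
  have hder : fderiv ℝ (δSA f g) x₀ (g x₀) ≠ 0 := by
    rw [fderiv_δSA_apply hf hg hx₀ hgx]
    exact hB x₀ hx₀
  refine ⟨fun h => hder ?_, ?_⟩
  · have : fderiv ℝ (δSA f g) x₀ = 0 := by simpa [gradient] using h
    simp [this]
  · have hV : IsOpen {x | det2 (f x) (g x) ≠ 0} :=
      isOpen_ne_fun (hf.det2 hg).continuous continuous_const
    have hδ : ContDiff ℝ (⊤ : ℕ∞) (δSA f g) := hg.det2 (hf.lieB hg)
    obtain ⟨U, hU, hxU, hUV, h⟩ :=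
      exists_param_zeroSet (hδ.contDiffAt.of_le (by norm_cast)) hx₀ hder hV hfg
    exact ⟨U, hU, hxU, hUV, h⟩
end
end

section
/- Suppose Assumption A3 holds at a solution (t_b*, z_b*, λ*) of F = 0, let σ(t_b) = (z_b(t_b), λ(t_b)) be the C¹ implicit solution of G(t_b, σ(t_b)) = 0 near t_b* with σ(t_b*) = (z_b*, λ*), and define the switching curve parametrization φ(t_b) := exp(−t_b H⃗₊)(z_b(t_b)) and z_e := exp(−t_b* H⃗₊)(z_b*). Then φ'(t_b*) = −H⃗₊(z_e); in particular, the switching curve Σ := {φ(t_b)} is tangent at z_e to the forward semi-orbit Γ₊ of ż = H⃗₊(z) starting from z_e. -/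
open Set
open scoped RealInnerProductSpace

noncomputable section

/-- The cotangent bundle `ℝ² × ℝ² ≅ ℝ⁴`; `z = (x,p)`. -/
abbrev Z4 : Type := E2 × E2

/-- Hamiltonian lift `H_h(z) = p·h(x)`. -/
def Hlift (h : E2 → E2) (z : Z4) : ℝ := ⟪z.2, h z.1⟫

/-- The Hamiltonian vector field of `H₊ = H_f + H_g`:
`H⃗₊(x,p) = ((f+g)(x), −(Df(x)+Dg(x))ᵀ p)`. -/
def HvecPlus (f g : E2 → E2) (z : Z4) : Z4 :=
  (f z.1 + g z.1,
   -(ContinuousLinearMap.adjoint (fderiv ℝ f z.1 + fderiv ℝ g z.1)) z.2)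

/-- The map `G(t_b,z_b,λ) = (H_g(exp(−t_b H⃗₊)(z_b)), H₊(z_b) − 1, Ψ(z_b,λ))`,
with the normal multiplier `p⁰ = −1`. -/
def Gmap (f g : E2 → E2) (Φ : ℝ → Z4 → Z4) (k : ℕ)
    (Ψ : Z4 → EuclideanSpace ℝ (Fin k) → EuclideanSpace ℝ (Fin (2+k)))
    (tb : ℝ) (zb : Z4) (lam : EuclideanSpace ℝ (Fin k)) :
    ℝ × ℝ × EuclideanSpace ℝ (Fin (2+k)) :=
  (Hlift g (Φ (-tb) zb), Hlift (fun x => f x + g x) zb - 1, Ψ zb lam)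

/-- The map `F(t_b,z_b,λ) = (H_{[f,g]}(exp(−t_b H⃗₊)(z_b)), G(t_b,z_b,λ))`. -/
def Fmap (f g : E2 → E2) (Φ : ℝ → Z4 → Z4) (k : ℕ)
    (Ψ : Z4 → EuclideanSpace ℝ (Fin k) → EuclideanSpace ℝ (Fin (2+k)))
    (tb : ℝ) (zb : Z4) (lam : EuclideanSpace ℝ (Fin k)) :
    ℝ × ℝ × ℝ × EuclideanSpace ℝ (Fin (2+k)) :=
  (Hlift (lieB f g) (Φ (-tb) zb), Gmap f g Φ k Ψ tb zb lam)

/-- Along the flow of `H⃗₊`, the lift `H_g` has derivative `H_{[f,g]}`. -/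
theorem hasDerivAt_Hlift_of_HvecPlus {f g : E2 → E2} (hg : Differentiable ℝ g)
    {γ : ℝ → Z4} {t : ℝ} (hγ : HasDerivAt γ (HvecPlus f g (γ t)) t) :
    HasDerivAt (fun s => Hlift g (γ s)) (Hlift (lieB f g) (γ t)) t := by
  have hx : HasDerivAt (fun s => (γ s).1) (f (γ t).1 + g (γ t).1) t := hγ.fst
  have hp : HasDerivAt (fun s => (γ s).2)
      (-(ContinuousLinearMap.adjoint (fderiv ℝ f (γ t).1 + fderiv ℝ g (γ t).1)) (γ t).2) t :=
    hγ.snd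
  have hgx : HasDerivAt (fun s => g (γ s).1)
      (fderiv ℝ g (γ t).1 (f (γ t).1 + g (γ t).1)) t :=
    (hg (γ t).1).hasFDerivAt.comp_hasDerivAt t hx
  refine (hp.inner ℝ hgx).congr_deriv ?_
  rw [inner_neg_left, ContinuousLinearMap.adjoint_inner_left]
  simp only [Hlift, lieB, add_apply, map_add, inner_add_right,
    inner_sub_right]
  ring

/-- The lift of a smooth vector field is smooth. -/
theorem ContDiff.Hlift {n : WithTop ℕ∞} {h : E2 → E2} (hh : ContDiff ℝ n h) :
    ContDiff ℝ n (Hlift h) :=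
  contDiff_snd.inner ℝ (hh.comp contDiff_fst)

/-- A curve in the zero set of `G`, parametrized by its first variable, is stationary at a point
where the time derivative of `G` vanishes and its partial derivative in the remaining variables
is injective. -/
theorem hasDerivAt_zero_of_implicit {E F : Type*} [NormedAddCommGroup E] [NormedSpace ℝ E]
    [NormedAddCommGroup F] [NormedSpace ℝ F] {G : ℝ × E → F} {σ : ℝ → E} {t : ℝ}
    (hG : DifferentiableAt ℝ G (t, σ t)) (hσ : DifferentiableAt ℝ σ t)
    (hGσ : ∀ᶠ s in nhds t, G (s, σ s) = 0)
    (htime : HasDerivAt (fun s => G (s, σ t)) 0 t)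
    (hinj : Function.Injective (fderiv ℝ (fun y => G (t, y)) (σ t))) :
    HasDerivAt σ 0 t := by
  set L := fderiv ℝ G (t, σ t) with hL
  have hcurve : L (1, deriv σ t) = 0 :=
    (hG.hasFDerivAt.comp_hasDerivAt t ((hasDerivAt_id t).prodMk hσ.hasDerivAt)).unique
      ((hasDerivAt_const t (0 : F)).congr_of_eventuallyEq hGσ)
  have htime' : L (1, 0) = 0 :=
    (hG.hasFDerivAt.comp_hasDerivAt t
      ((hasDerivAt_id t).prodMk (hasDerivAt_const t (σ t)))).unique htime
  have hpart : fderiv ℝ (fun y => G (t, y)) (σ t) = L.comp (ContinuousLinearMap.inr ℝ ℝ E) :=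
    (hG.hasFDerivAt.comp (σ t) (hasFDerivAt_prodMk_right t (σ t))).fderiv
  have hzero : deriv σ t = 0 := by
    apply hinj
    have hsplit : ((0 : ℝ), deriv σ t) = (1, deriv σ t) - (1, 0) := by simp
    rw [map_zero, hpart, ContinuousLinearMap.comp_apply, ContinuousLinearMap.inr_apply,
      hsplit, map_sub, hcurve, htime', sub_zero]
  exact hzero ▸ hσ.hasDerivAt

/-- Theorem `thm-tangent`: under Assumption A3, with
`σ(t_b) = (z_b(t_b), λ(t_b))` the C¹ implicit solution of `G(t_b,σ(t_b)) = 0`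
near `t_b*` with `σ(t_b*) = (z_b*, λ*)`, the switching-curve parametrization
`φ(t_b) = exp(−t_b H⃗₊)(z_b(t_b))` satisfies `φ'(t_b*) = −H⃗₊(z_e)` with
`z_e = exp(−t_b* H⃗₊)(z_b*)`: the switching curve `Σ` is tangent at `z_e` to
the forward semi-orbit `Γ₊` of `ż = H⃗₊(z)` issued from `z_e`. -/
theorem stmt16 (f g : E2 → E2)
    (hf : ContDiff ℝ (⊤ : ℕ∞) f) (hg : ContDiff ℝ (⊤ : ℕ∞) g)
    (k : ℕ) (Ψ : Z4 → EuclideanSpace ℝ (Fin k) → EuclideanSpace ℝ (Fin (2+k)))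
    (hΨ : ContDiff ℝ (⊤ : ℕ∞) (fun q : Z4 × EuclideanSpace ℝ (Fin k) => Ψ q.1 q.2))
    -- the complete flow Φ of H⃗₊
    (Φ : ℝ → Z4 → Z4)
    (hΦsmooth : ContDiff ℝ (⊤ : ℕ∞) (fun q : ℝ × Z4 => Φ q.1 q.2))
    (hΦ0 : ∀ z : Z4, Φ 0 z = z)
    (hΦd : ∀ (t : ℝ) (z : Z4), HasDerivAt (fun s => Φ s z) (HvecPlus f g (Φ t z)) t)
    -- the solution of F = 0 and the prior-saturation lift z_e
    (tbs : ℝ) (zbs : Z4) (lams : EuclideanSpace ℝ (Fin k))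
    (hsol : Fmap f g Φ k Ψ tbs zbs lams = 0)
    (ze : Z4) (hze : ze = Φ (-tbs) zbs)
    -- Assumption A3
    (hA3 : Function.Bijective
      (fderiv ℝ (fun q : Z4 × EuclideanSpace ℝ (Fin k) =>
        Gmap f g Φ k Ψ tbs q.1 q.2) (zbs, lams)))
    -- the C¹ implicit solution σ of G = 0 near t_b*
    (ε : ℝ) (hε : 0 < ε) (σ : ℝ → Z4 × EuclideanSpace ℝ (Fin k))
    (hσC1 : ContDiffOn ℝ 1 σ (Ioo (tbs - ε) (tbs + ε)))
    (hσG : ∀ tb ∈ Ioo (tbs - ε) (tbs + ε),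
      Gmap f g Φ k Ψ tb (σ tb).1 (σ tb).2 = 0)
    (hσs : σ tbs = (zbs, lams)) :
    HasDerivAt (fun tb : ℝ => Φ (-tb) (σ tb).1) (-(HvecPlus f g ze)) tbs := by
  have hI : Ioo (tbs - ε) (tbs + ε) ∈ nhds tbs := Ioo_mem_nhds (by linarith) (by linarith)
  have hσd : DifferentiableAt ℝ σ tbs := (hσC1.contDiffAt hI).differentiableAt one_ne_zero
  have hΦrev : ContDiff ℝ (⊤ : ℕ∞)
      (fun q : ℝ × (Z4 × EuclideanSpace ℝ (Fin k)) => Φ (-q.1) q.2.1) :=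
    hΦsmooth.comp (contDiff_fst.neg.prodMk (contDiff_fst.comp contDiff_snd))
  have hGsmooth : ContDiff ℝ (⊤ : ℕ∞)
      (fun q : ℝ × (Z4 × EuclideanSpace ℝ (Fin k)) => Gmap f g Φ k Ψ q.1 q.2.1 q.2.2) :=
    (hg.Hlift.comp hΦrev).prodMk
      ((((hf.add hg).Hlift.comp (contDiff_fst.comp contDiff_snd)).sub contDiff_const).prodMk
        (hΨ.comp contDiff_snd))
  have hbracket : Hlift (lieB f g) (Φ (-tbs) zbs) = 0 := congrArg Prod.fst hsol
  have hswitch : HasDerivAt (fun s => Hlift g (Φ (-s) zbs)) 0 tbs := by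
    have h := (hasDerivAt_Hlift_of_HvecPlus (hg.differentiable (by simp))
      (hΦd (-tbs) zbs)).scomp tbs (hasDerivAt_neg tbs)
    rw [hbracket, smul_zero] at h
    exact h
  have hσ0 : HasDerivAt σ 0 tbs := by
    refine hasDerivAt_zero_of_implicit (hGsmooth.differentiable (by simp) _) hσd
      (Filter.mem_of_superset hI hσG) ?_ ?_
    · rw [hσs]
      exact hswitch.prodMk (hasDerivAt_const tbs
        (Hlift (fun x => f x + g x) zbs - 1, Ψ zbs lams))
    · rw [hσs]
      exact hA3.injective
  have hΦat : HasFDerivAt (fun q : ℝ × Z4 => Φ q.1 q.2)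
      (fderiv ℝ (fun q : ℝ × Z4 => Φ q.1 q.2) (-tbs, zbs)) (-tbs, (σ tbs).1) := by
    rw [hσs]
    exact (hΦsmooth.differentiable (by simp) _).hasFDerivAt
  have hφ := hΦat.comp_hasDerivAt tbs ((hasDerivAt_neg tbs).prodMk hσ0.fst)
  have hflow : HasDerivAt (fun s => Φ (-s) zbs) (-(HvecPlus f g ze)) tbs := by
    have h := (hΦd (-tbs) zbs).scomp tbs (hasDerivAt_neg tbs)
    rw [neg_one_smul, ← hze] at h
    exact h
  have hfrozen := (hΦsmooth.differentiable (by simp) (-tbs, zbs)).hasFDerivAt.comp_hasDerivAt tbs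
    ((hasDerivAt_neg tbs).prodMk (hasDerivAt_const tbs zbs))
  exact hφ.congr_deriv (hfrozen.unique hflow)
end
end
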